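/- Let c be a real constant and let θ : ℝ → ℝ be twice differentiable with θ''(t) = 4c·sin(θ(t)) for all t. Set E = θ'(0)²/2 + 4c·cos(θ(0)) and define u : ℝ → ℂ by u(t) = exp(i·θ(t)). Then u is twice differentiable and satisfies the polynomial differential equation u''(t) = 6c·u(t)² − 2E·u(t) + 2c for all t ∈ ℝ. -/

import Mathlib

/-- Conservation of energy for the pendulum `θ'' = 4c sin θ`. -/
theorem pendulum_energy_eq (c : ℝ) (θ θ' : ℝ → ℝ) (hθ : ∀ t, HasDerivAt θ (θ' t) t)
    (hθ' : ∀ t, HasDerivAt θ' (4 * c * Real.sin (θ t)) t) (s t : ℝ) :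
    θ' s ^ 2 / 2 + 4 * c * Real.cos (θ s) = θ' t ^ 2 / 2 + 4 * c * Real.cos (θ t) := by
  have hderiv (x : ℝ) :
      HasDerivAt (fun x => θ' x ^ 2 / 2 + 4 * c * Real.cos (θ x)) 0 x := by
    refine ((((hθ' x).pow 2).div_const 2).add ((hθ x).cos.const_mul (4 * c))).congr_deriv ?_
    push_cast
    ring
  exact is_const_of_deriv_eq_zero (fun x => (hderiv x).differentiableAt)
    (fun x => (hderiv x).deriv) s t

/-- The polynomial pendulum equation: if `θ'' = 4c sin θ` with energy
`E = θ'(0)²/2 + 4c cos(θ(0))`, then `u = exp(iθ)` is twice differentiable and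
satisfies `u'' = 6c u² − 2E u + 2c`. -/
theorem pendulum_polynomial_equation (c : ℝ) (θ θ' θ'' : ℝ → ℝ)
    (hθ : ∀ t, HasDerivAt θ (θ' t) t)
    (hθ' : ∀ t, HasDerivAt θ' (θ'' t) t)
    (heq : ∀ t, θ'' t = 4 * c * Real.sin (θ t))
    (E : ℝ) (hE : E = θ' 0 ^ 2 / 2 + 4 * c * Real.cos (θ 0))
    (u : ℝ → ℂ) (hu : ∀ t, u t = Complex.exp (Complex.I * (θ t))) :
    ∃ u' : ℝ → ℂ, (∀ t, HasDerivAt u (u' t) t) ∧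
      ∀ t, HasDerivAt u' (6 * (c : ℂ) * (u t) ^ 2 - 2 * (E : ℂ) * u t + 2 * (c : ℂ)) t := by
  have henergy (t : ℝ) : E = θ' t ^ 2 / 2 + 4 * c * Real.cos (θ t) :=
    hE.trans (pendulum_energy_eq c θ θ' hθ (fun x => heq x ▸ hθ' x) 0 t)
  have hderiv (t : ℝ) : HasDerivAt u (Complex.I * θ' t * u t) t := by
    obtain rfl : u = fun t => Complex.exp (Complex.I * θ t) := funext hu
    refine ((hθ t).ofReal_comp.const_mul Complex.I).cexp.congr_deriv ?_
    ring
  refine ⟨fun t => Complex.I * θ' t * u t, hderiv, fun t => ?_⟩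
  refine (((hθ' t).ofReal_comp.const_mul Complex.I).mul (hderiv t)).congr_deriv ?_
  have hexp : u t = Complex.cos (θ t) + Complex.sin (θ t) * Complex.I := by
    rw [hu, mul_comm, Complex.exp_mul_I]
  rw [hexp, heq, henergy t]
  push_cast
  linear_combination
    (2 * c : ℂ) * Complex.sin_sq_add_cos_sq (θ t : ℂ) +
      (-2 * c * Complex.sin (θ t) ^ 2 +
        θ' t ^ 2 * (Complex.cos (θ t) + Complex.sin (θ t) * Complex.I)) * Complex.I_sq
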